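/- Assume: uniform stability μ_h ≤ μ̄ for all h > 0; approximability (for every v ∈ V, inf_{v_h ∈ V_h}‖v − v_h‖ → 0 as h → 0); I : V₁ → W is compact; the limiting compactness property (for every sequence h_k → 0 and every (d_k) in V₂ converging weakly to 0, C_{h_k}* d_k → 0 strongly in Q); and M̃ := sup_h M̃_h < ∞; set L̃ = M̃/√α and κ̃ = ((1+2L̃)/(1+L̃))·(1 + M̃·μ̄·(1 + 2M̃/√α)). Let x ∈ V solve b(x,φ) = −α^{−1/2}⟨u_d, Iφ₁⟩_W for all φ ∈ V and, for each h, let x̃_h ∈ V_h solve b_h(x̃_h,φ_h) = −α^{−1/2}⟨u_d, Iφ_{h,1}⟩_W for all φ_h ∈ V_h. If there is ε₁ : (0,∞) → [0,∞) with ε₁(h) → 0 as h → 0 such that sup over nonzero φ_h ∈ V_h of [⟨C_h*x₂, C_h*φ_{h,2}⟩_Q − ⟨C*x₂, C*φ_{h,2}⟩_Q]/‖φ_h‖_{α,h} ≤ ε₁(h)·inf_{v_h ∈ V_h}‖x − v_h‖, then there exists ε : (0,∞) → [0,∞) with ε(h) → 0 as h → 0 such that ‖x − x̃_h‖ ≤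 μ_h·(1 + (κ̃/√α)·ε(h))·inf_{v_h ∈ V_h}‖x − v_h‖ for all h. -/

import Mathlib

open scoped RealInnerProductSpace
open Filter Topology

noncomputable section Setup

variable {V₁ V₂ Q W : Type*}
  [NormedAddCommGroup V₁] [InnerProductSpace ℝ V₁]
  [NormedAddCommGroup V₂] [InnerProductSpace ℝ V₂]
  [NormedAddCommGroup Q] [InnerProductSpace ℝ Q]
  [NormedAddCommGroup W] [InnerProductSpace ℝ W]

/-- The ℓ²-norm on the product space `V = V₁ × V₂`. -/
def nV (v : V₁ × V₂) : ℝ := Real.sqrt (‖v.1‖ ^ 2 + ‖v.2‖ ^ 2)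

/-- The seminorm `|v| = (‖I v₁‖² + ‖C* v₂‖²)^{1/2}`. -/
def sV (Cs : V₂ →L[ℝ] Q) (Iop : V₁ →L[ℝ] W) (v : V₁ × V₂) : ℝ :=
  Real.sqrt (‖Iop v.1‖ ^ 2 + ‖Cs v.2‖ ^ 2)

/-- The vectorized bilinear form `a(v,φ) = a(v₁,φ₂) + a(φ₁,v₂)` on `V × V`. -/
def aV (a : V₁ →L[ℝ] V₂ →L[ℝ] ℝ) (v φ : V₁ × V₂) : ℝ := a v.1 φ.2 + a φ.1 v.2

/-- The bilinear form `b = a + α^{-1/2} c` of the rescaled reduced optimality system. -/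
def bV (a : V₁ →L[ℝ] V₂ →L[ℝ] ℝ) (Cs : V₂ →L[ℝ] Q) (Iop : V₁ →L[ℝ] W) (α : ℝ)
    (v φ : V₁ × V₂) : ℝ :=
  aV a v φ + (Real.sqrt α)⁻¹ * (⟪Cs v.2, Cs φ.2⟫ - ⟪Iop v.1, Iop φ.1⟫)

/-- Continuity constant `M_a = sup { a(v₁,v₂) : ‖v₁‖ = 1, ‖v₂‖ = 1 }`. -/
def contConst (a : V₁ →L[ℝ] V₂ →L[ℝ] ℝ) : ℝ :=
  sSup {r : ℝ | ∃ v₁ : V₁, ∃ v₂ : V₂, ‖v₁‖ = 1 ∧ ‖v₂‖ = 1 ∧ r = a v₁ v₂}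

/-- Inf-sup constant `m_a = inf_{‖v₂‖=1} sup_{‖v₁‖=1} a(v₁,v₂)`. -/
def infSupConst (a : V₁ →L[ℝ] V₂ →L[ℝ] ℝ) : ℝ :=
  sInf {r : ℝ | ∃ v₂ : V₂, ‖v₂‖ = 1 ∧
    r = sSup {s : ℝ | ∃ v₁ : V₁, ‖v₁‖ = 1 ∧ s = a v₁ v₂}}

/-- Discrete inf-sup constant of `a` on `V_{h,1} × V_{h,2}`. -/
def discInfSup (a : V₁ →L[ℝ] V₂ →L[ℝ] ℝ) (Vh1 : Submodule ℝ V₁)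
    (Vh2 : Submodule ℝ V₂) : ℝ :=
  sInf {r : ℝ | ∃ v₁ ∈ Vh1, ‖v₁‖ = 1 ∧
    r = sSup {s : ℝ | ∃ φ₂ ∈ Vh2, ‖φ₂‖ = 1 ∧ s = a v₁ φ₂}}

/-- Best approximation error `inf_{v_h ∈ V_h} ‖x - v_h‖` in the product norm. -/
def bestErr (Vh1 : Submodule ℝ V₁) (Vh2 : Submodule ℝ V₂) (x : V₁ × V₂) : ℝ :=
  sInf {r : ℝ | ∃ vh : V₁ × V₂, vh.1 ∈ Vh1 ∧ vh.2 ∈ Vh2 ∧ r = nV (x - vh)}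

/-- The quasi-best-approximation constant `ν_h` of the Galerkin discretization of `b`:
`sup` over nonzero discrete test functions of the ratio of the continuous sup to the
discrete sup. -/
def nuConst (a : V₁ →L[ℝ] V₂ →L[ℝ] ℝ) (Cs : V₂ →L[ℝ] Q) (Iop : V₁ →L[ℝ] W) (α : ℝ)
    (Vh1 : Submodule ℝ V₁) (Vh2 : Submodule ℝ V₂) : ℝ :=
  sSup {r : ℝ | ∃ φh : V₁ × V₂, φh.1 ∈ Vh1 ∧ φh.2 ∈ Vh2 ∧ φh ≠ 0 ∧
    r = sSup {s : ℝ | ∃ v : V₁ × V₂, nV v = 1 ∧ s = bV a Cs Iop α v φh} /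
        sSup {s : ℝ | ∃ vh : V₁ × V₂, vh.1 ∈ Vh1 ∧ vh.2 ∈ Vh2 ∧ nV vh = 1 ∧
          s = bV a Cs Iop α vh φh}}

/-- The nonlinear form `c_{K,α}` associated with the control constraint set `K`
(through its metric projection `PK`). -/
def cK (Cs : V₂ →L[ℝ] Q) (Iop : V₁ →L[ℝ] W) (PK : Q → Q) (α : ℝ) (v φ : V₁ × V₂) : ℝ :=
  -⟪PK ((-(Real.sqrt α)⁻¹) • (Cs v.2)), Cs φ.2⟫ - (Real.sqrt α)⁻¹ * ⟪Iop v.1, Iop φ.1⟫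

/-- The nonlinear form `b_K = a + c_{K,α}`. -/
def bK (a : V₁ →L[ℝ] V₂ →L[ℝ] ℝ) (Cs : V₂ →L[ℝ] Q) (Iop : V₁ →L[ℝ] W) (PK : Q → Q)
    (α : ℝ) (v φ : V₁ × V₂) : ℝ :=
  aV a v φ + cK Cs Iop PK α v φ

/-- The pseudometric `δ_{K,α}`. -/
def deltaK (Cs : V₂ →L[ℝ] Q) (Iop : V₁ →L[ℝ] W) (PK : Q → Q) (α : ℝ)
    (v w : V₁ × V₂) : ℝ :=
  Real.sqrt (α * ‖PK ((-(Real.sqrt α)⁻¹) • (Cs v.2)) -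
      PK ((-(Real.sqrt α)⁻¹) • (Cs w.2))‖ ^ 2 + ‖Iop (v.1 - w.1)‖ ^ 2)

end Setup

section InnerProductSpace

variable {H : Type*} [NormedAddCommGroup H] [InnerProductSpace ℝ H]

/-- If no nonzero vector of `S` is orthogonal to `U`, then the orthogonal projection onto `S`
maps `U` onto `S`. -/
theorem exists_starProjection_eq (U S : Submodule ℝ H) [FiniteDimensional ℝ S]
    (hS : ∀ s ∈ S, (∀ u ∈ U, ⟪u, s⟫ = 0) → s = 0) {s : H} (hs : s ∈ S) :
    ∃ u ∈ U, S.starProjection u = s := by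
  let f : U →ₗ[ℝ] S := (S.orthogonalProjectionOnto : H →ₗ[ℝ] S) ∘ₗ U.subtype
  have hf : LinearMap.range f = ⊤ := by
    rw [← Submodule.orthogonal_eq_bot_iff, Submodule.eq_bot_iff]
    intro t ht
    have h0 : (t : H) = 0 := hS t t.2 fun u hu => by
      have := (Submodule.mem_orthogonal _ _).1 ht (f ⟨u, hu⟩) ⟨_, rfl⟩
      simpa [f] using this
    exact Subtype.ext h0
  obtain ⟨u, hu⟩ := LinearMap.range_eq_top.1 hf ⟨s, hs⟩
  exact ⟨u, u.2, congrArg Subtype.val hu⟩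

/-- The inf-sup condition for a pair of subspaces is symmetric in the two subspaces. -/
theorem norm_le_mul_norm_starProjection_symm (U S : Submodule ℝ H) [FiniteDimensional ℝ U]
    [FiniteDimensional ℝ S] {m : ℝ} (hU : ∀ u ∈ U, ‖u‖ ≤ m * ‖S.starProjection u‖)
    (hS : ∀ s ∈ S, (∀ u ∈ U, ⟪u, s⟫ = 0) → s = 0) {s : H} (hs : s ∈ S) :
    ‖s‖ ≤ m * ‖U.starProjection s‖ := by
  obtain ⟨u, hu, rfl⟩ := exists_starProjection_eq U S hS hs
  set s := S.starProjection u
  have h1 : ‖s‖ ^ 2 = ⟪u, U.starProjection s⟫ := by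
    rw [← Submodule.inner_starProjection_left_eq_right, Submodule.starProjection_eq_self_iff.2 hu,
      ← real_inner_self_eq_norm_sq, Submodule.inner_starProjection_left_eq_right,
      Submodule.starProjection_eq_self_iff.2 hs]
  have h2 : ‖s‖ ^ 2 ≤ ‖s‖ * (m * ‖U.starProjection s‖) := by
    calc ‖s‖ ^ 2 ≤ ‖u‖ * ‖U.starProjection s‖ := h1 ▸ real_inner_le_norm _ _
      _ ≤ (m * ‖s‖) * ‖U.starProjection s‖ := by gcongr; exact hU u hu
      _ = _ := by ring
  rcases (norm_nonneg s).eq_or_lt with h0 | h0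
  · have hz : s = 0 := norm_eq_zero.1 h0.symm
    simp [hz]
  · exact le_of_mul_le_mul_left (by linarith) h0

/-- Quasi-optimality of the Petrov-Galerkin projection, with the reciprocal of the inf-sup constant
as quasi-optimality constant. -/
theorem exists_petrovGalerkin (U S : Submodule ℝ H) [FiniteDimensional ℝ U]
    [FiniteDimensional ℝ S] {m : ℝ} (hm : 1 ≤ m) (hU : ∀ u ∈ U, ‖u‖ ≤ m * ‖S.starProjection u‖)
    (hS : ∀ s ∈ S, (∀ u ∈ U, ⟪u, s⟫ = 0) → s = 0) (x : H) :
    ∃ p ∈ U, (∀ s ∈ S, ⟪x - p, s⟫ = 0) ∧ ∀ u ∈ U, ‖x - p‖ ≤ m * ‖x - u‖ := by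
  set y := x - U.starProjection x with hy
  obtain ⟨p, hp, hpy⟩ := exists_starProjection_eq U S hS (S.starProjection_apply_mem y)
  have horth : ∀ s ∈ S, ⟪y - p, s⟫ = 0 := fun s hs => by
    rw [← Submodule.starProjection_eq_self_iff.2 hs,
      ← Submodule.inner_starProjection_left_eq_right, map_sub, hpy, sub_self, inner_zero_left]
  have hzy : x - (U.starProjection x + p) = y - p := by rw [hy]; abel
  have hyU : ∀ u ∈ U, ⟪y, u⟫ = 0 := fun u hu => Submodule.starProjection_inner_eq_zero x u hu
  have hmain : ‖y - p‖ ≤ m * ‖y‖ := by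
    set q := S.starProjection p with hq
    have hqS : q ∈ S := S.starProjection_apply_mem p
    have hZ : ‖y - p‖ ^ 2 = ‖y‖ ^ 2 + ‖p‖ ^ 2 := by
      rw [norm_sub_sq_real, hyU p hp]; ring
    have hpq : ⟪p, q⟫ = ‖q‖ ^ 2 := by
      rw [← real_inner_self_eq_norm_sq]
      conv_rhs => rw [hq, Submodule.inner_starProjection_left_eq_right,
        Submodule.starProjection_eq_self_iff.2 hqS]
    have hd : ‖p - q‖ ^ 2 = ‖p‖ ^ 2 - ‖q‖ ^ 2 := by
      rw [norm_sub_sq_real, hpq]; ring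
    have hin : ⟪y - p, p - q⟫ = -‖p‖ ^ 2 := by
      rw [inner_sub_right, horth q hqS, inner_sub_left, hyU p hp, real_inner_self_eq_norm_sq]
      ring
    have hcs : (‖p‖ ^ 2) ^ 2 ≤ (‖p‖ ^ 2 - ‖q‖ ^ 2) * ‖y - p‖ ^ 2 := by
      have := abs_real_inner_le_norm (y - p) (p - q)
      rw [hin, abs_neg, abs_of_nonneg (sq_nonneg _)] at this
      rw [← hd, mul_comm, ← mul_pow]
      gcongr
    have hpm : ‖p‖ ^ 2 ≤ m ^ 2 * ‖q‖ ^ 2 := by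
      rw [← mul_pow]; gcongr; exact hU p hp
    refine le_of_abs_le (abs_le_of_sq_le_sq ?_ (by positivity))
    rw [mul_pow]
    rcases (sq_nonneg ‖p‖).eq_or_lt with h0 | h0
    · rw [hZ, ← h0]
      nlinarith [mul_le_mul_of_nonneg_right (one_le_pow₀ hm : 1 ≤ m ^ 2) (sq_nonneg ‖y‖)]
    · refine le_of_mul_le_mul_left ?_ h0
      have h1 := mul_le_mul_of_nonneg_right hpm (sq_nonneg ‖y - p‖)
      have h2 : ‖q‖ ^ 2 * ‖y - p‖ ^ 2 ≤ ‖p‖ ^ 2 * ‖y‖ ^ 2 := by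
        have : ‖y‖ ^ 2 = ‖y - p‖ ^ 2 - ‖p‖ ^ 2 := by linarith
        rw [this]; nlinarith
      nlinarith [mul_le_mul_of_nonneg_left h2 (sq_nonneg m)]
  refine ⟨U.starProjection x + p, U.add_mem (U.starProjection_apply_mem x) hp, ?_, ?_⟩
  · rwa [hzy]
  · intro u hu
    rw [hzy]
    refine hmain.trans (mul_le_mul_of_nonneg_left ?_ (by linarith))
    have hsplit : x - u = y + (U.starProjection x - u) := by rw [hy]; abel
    have h0 := hyU _ (U.sub_mem (U.starProjection_apply_mem x) hu)
    refine le_of_abs_le (abs_le_of_sq_le_sq ?_ (norm_nonneg _))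
    rw [hsplit, norm_add_sq_real, h0]
    nlinarith [sq_nonneg ‖U.starProjection x - u‖]

/-- If pairing with `u` is bounded by `D` on `S`, the projection of `u` onto `S` has norm at most `D`. -/
theorem norm_starProjection_le (S : Submodule ℝ H) [S.HasOrthogonalProjection] {u : H} {D : ℝ}
    (hD : 0 ≤ D) (h : ∀ s ∈ S, ⟪u, s⟫ ≤ D * ‖s‖) : ‖S.starProjection u‖ ≤ D := by
  have h1 := h _ (S.starProjection_apply_mem u)
  have h2 : ⟪u, S.starProjection u⟫ = ‖S.starProjection u‖ ^ 2 := by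
    rw [← real_inner_self_eq_norm_sq, Submodule.inner_starProjection_left_eq_right,
      Submodule.starProjection_eq_self_iff.2 (S.starProjection_apply_mem u)]
  rw [h2] at h1
  by_contra! hc
  nlinarith

/-- A compact operator maps bounded weakly null families to strongly null families. -/
theorem IsCompactOperator.tendsto_zero_of_weakly {ι W : Type*} [CompleteSpace H]
    [NormedAddCommGroup W] [InnerProductSpace ℝ W] [CompleteSpace W] {T : H →L[ℝ] W}
    (hT : IsCompactOperator (⇑T)) {l : Filter ι} {d : ι → H} {B : ℝ}
    (hB : ∀ᶠ i in l, ‖d i‖ ≤ B) (hd : ∀ y, Tendsto (fun i => ⟪d i, y⟫) l (𝓝 0)) :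
    Tendsto (fun i => T (d i)) l (𝓝 0) := by
  obtain ⟨K, hK, hTK⟩ := hT.image_subset_compact_of_bounded
    (Metric.isBounded_closedBall (x := (0 : H)) (r := B))
  refine hK.tendsto_nhds_of_unique_mapClusterPt (hB.mono fun i hi => hTK ⟨d i, by simpa, rfl⟩) ?_
  intro z _ hz
  have hlim : Tendsto (fun i => ⟪T (d i), z⟫) l (𝓝 0) := by
    simpa [ContinuousLinearMap.adjoint_inner_right] using hd (ContinuousLinearMap.adjoint T z)
  have hcl : MapClusterPt ⟪z, z⟫ l (fun i => ⟪T (d i), z⟫) :=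
    hz.continuousAt_comp (f := fun w => ⟪w, z⟫) (by fun_prop)
  have : ⟪z, z⟫ = 0 := by
    have hne : (𝓝 ⟪z, z⟫ ⊓ 𝓝 (0 : ℝ)).NeBot := hcl.neBot.mono (inf_le_inf_left _ hlim)
    exact eq_of_nhds_neBot hne
  exact inner_self_eq_zero.1 this

end InnerProductSpace

section NormedGroup

variable {V₁ V₂ : Type*} [NormedAddCommGroup V₁] [NormedAddCommGroup V₂]

theorem nV_nonneg (v : V₁ × V₂) : 0 ≤ nV v := Real.sqrt_nonneg _

theorem norm_fst_le_nV (v : V₁ × V₂) : ‖v.1‖ ≤ nV v :=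
  Real.le_sqrt_of_sq_le (by nlinarith [sq_nonneg ‖v.2‖])

theorem norm_snd_le_nV (v : V₁ × V₂) : ‖v.2‖ ≤ nV v :=
  Real.le_sqrt_of_sq_le (by nlinarith [sq_nonneg ‖v.1‖])

theorem nV_le_add (v : V₁ × V₂) : nV v ≤ ‖v.1‖ + ‖v.2‖ :=
  Real.sqrt_le_iff.2 ⟨by positivity, by nlinarith [mul_nonneg (norm_nonneg v.1) (norm_nonneg v.2)]⟩

theorem nV_eq_norm (v : V₁ × V₂) : nV v = ‖WithLp.toLp 2 v‖ :=
  (WithLp.prod_norm_eq_of_L2 _).symm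

theorem nV_add_le (v w : V₁ × V₂) : nV (v + w) ≤ nV v + nV w := by
  simpa only [nV_eq_norm, WithLp.toLp_add] using norm_add_le _ _

theorem nV_pos {v : V₁ × V₂} (hv : v ≠ 0) : 0 < nV v := by
  rw [nV_eq_norm, norm_pos_iff]
  simpa using hv

end NormedGroup

section SaddlePoint

variable {V₁ V₂ Q W : Type*}
  [NormedAddCommGroup V₁] [InnerProductSpace ℝ V₁]
  [NormedAddCommGroup V₂] [InnerProductSpace ℝ V₂]
  [NormedAddCommGroup Q] [InnerProductSpace ℝ Q]
  [NormedAddCommGroup W] [InnerProductSpace ℝ W]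

theorem sV_le {C : V₂ →L[ℝ] Q} {T : V₁ →L[ℝ] W} {M : ℝ} (hC : ‖C‖ ≤ M) (hT : ‖T‖ ≤ M)
    (v : V₁ × V₂) : sV C T v ≤ M * (‖v.1‖ + ‖v.2‖) :=
  calc sV C T v ≤ ‖T v.1‖ + ‖C v.2‖ := nV_le_add (T v.1, C v.2)
    _ ≤ M * ‖v.1‖ + M * ‖v.2‖ :=
      add_le_add (T.le_of_opNorm_le hT _) (C.le_of_opNorm_le hC _)
    _ = _ := by ring

theorem le_mul_bestErr {U : Submodule ℝ V₁} {S : Submodule ℝ V₂} {x : V₁ × V₂} {c K : ℝ}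
    (hK : 0 < K) (h : ∀ v : V₁ × V₂, v.1 ∈ U → v.2 ∈ S → c ≤ K * nV (x - v)) :
    c ≤ K * bestErr U S x := by
  rw [← div_le_iff₀' hK]
  refine le_csInf ⟨_, 0, U.zero_mem, S.zero_mem, rfl⟩ ?_
  rintro r ⟨v, hv1, hv2, rfl⟩
  rw [div_le_iff₀' hK]
  exact h v hv1 hv2

theorem bestErr_nonneg (U : Submodule ℝ V₁) (S : Submodule ℝ V₂) (x : V₁ × V₂) :
    0 ≤ bestErr U S x := by
  simpa using le_mul_bestErr (U := U) (S := S) (x := x) one_pos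
    fun v _ _ => by simpa using nV_nonneg (x - v)

/-- If `V₂` carries the adjoint norm, a form that is nondegenerate in its first argument is the
inner product of `V₁` up to an isometric isomorphism. -/
theorem exists_linearIsometryEquiv_of_adjoint_norm [CompleteSpace V₁] [CompleteSpace V₂]
    (a : V₁ →L[ℝ] V₂ →L[ℝ] ℝ) (hnd : ∀ v₁ : V₁, (∀ v₂ : V₂, a v₁ v₂ = 0) → v₁ = 0)
    (hadj : ∀ v₂ : V₂, ‖v₂‖ = sSup {r : ℝ | ∃ φ₁ : V₁, ‖φ₁‖ = 1 ∧ r = a φ₁ v₂}) :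
    ∃ e : V₂ ≃ₗᵢ[ℝ] V₁, ∀ v₁ v₂, a v₁ v₂ = ⟪v₁, e v₂⟫ := by
  let R : V₂ →ₗ[ℝ] V₁ :=
    { toFun := fun v => (InnerProductSpace.toDual ℝ V₁).symm (a.flip v)
      map_add' := by simp
      map_smul' := by simp }
  have hR : ∀ v₁ v₂, a v₁ v₂ = ⟪v₁, R v₂⟫ := fun v₁ v₂ => by
    rw [real_inner_comm]
    exact (InnerProductSpace.toDual_symm_apply (y := a.flip v₂) (x := v₁)).symm
  have hiso : ∀ v, ‖R v‖ = ‖v‖ := fun v => by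
    have hub : ∀ r ∈ {r : ℝ | ∃ φ₁ : V₁, ‖φ₁‖ = 1 ∧ r = a φ₁ v}, r ≤ ‖R v‖ := by
      rintro r ⟨φ, hφ, rfl⟩
      rw [hR]
      simpa [hφ] using real_inner_le_norm φ (R v)
    refine le_antisymm ?_ (hadj v ▸ Real.sSup_le hub (norm_nonneg _))
    rcases eq_or_ne (R v) 0 with h0 | h0
    · simp [h0]
    · rw [hadj v]
      refine le_csSup ⟨_, hub⟩ ⟨‖R v‖⁻¹ • R v, norm_smul_inv_norm h0, ?_⟩
      rw [hR, real_inner_smul_left, real_inner_self_eq_norm_sq]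
      have := norm_ne_zero_iff.2 h0
      field_simp
  let L : V₂ →ₗᵢ[ℝ] V₁ := ⟨R, hiso⟩
  have hsurj : Function.Surjective L := by
    have hcomp : CompleteSpace (LinearMap.range R) :=
      L.isometry.isUniformInducing.isComplete_range.completeSpace_coe
    have : LinearMap.range R = ⊤ := by
      rw [← Submodule.orthogonal_eq_bot_iff, Submodule.eq_bot_iff]
      intro t ht
      refine hnd t fun v => ?_
      rw [hR]
      exact (Submodule.mem_orthogonal' _ _).1 ht _ ⟨v, rfl⟩
    exact LinearMap.range_eq_top.1 this
  exact ⟨LinearIsometryEquiv.ofSurjective L hsurj, hR⟩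

theorem le_mul_norm_starProjection_of_discInfSup {a : V₁ →L[ℝ] V₂ →L[ℝ] ℝ} {e : V₂ ≃ₗᵢ[ℝ] V₁}
    (he : ∀ v₁ v₂, a v₁ v₂ = ⟪v₁, e v₂⟫) {U : Submodule ℝ V₁} {S : Submodule ℝ V₂}
    [FiniteDimensional ℝ S] {m : ℝ} (hm : 0 < m) (hmd : 1 / m = discInfSup a U S)
    {u : V₁} (hu : u ∈ U) :
    ‖u‖ ≤ m * ‖(S.map (e.toLinearEquiv : V₂ →ₗ[ℝ] V₁)).starProjection u‖ := by
  set S' := S.map (e.toLinearEquiv : V₂ →ₗ[ℝ] V₁)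
  have hpos : 0 < 1 / m := by positivity
  have hunit : ∀ v ∈ U, ‖v‖ = 1 → 1 / m ≤ ‖S'.starProjection v‖ := fun v hv hv1 => by
    have hbdd : BddBelow {r : ℝ | ∃ v₁ ∈ U, ‖v₁‖ = 1 ∧
        r = sSup {s : ℝ | ∃ φ₂ ∈ S, ‖φ₂‖ = 1 ∧ s = a v₁ φ₂}} := by
      by_contra hc
      rw [hmd, discInfSup, Real.sInf_of_not_bddBelow hc] at hpos
      exact hpos.false
    rw [hmd]
    refine (csInf_le hbdd ⟨v, hv, hv1, rfl⟩).trans (Real.sSup_le ?_ (norm_nonneg _))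
    rintro s ⟨φ, hφ, hφ1, rfl⟩
    have hmem : e φ ∈ S' := ⟨φ, hφ, rfl⟩
    rw [he, ← Submodule.starProjection_eq_self_iff.2 hmem,
      ← Submodule.inner_starProjection_left_eq_right]
    simpa [hφ1] using real_inner_le_norm (S'.starProjection v) (e φ)
  rcases eq_or_ne u 0 with rfl | h0
  · simp
  · have h1 := hunit (‖u‖⁻¹ • u) (U.smul_mem _ hu) (norm_smul_inv_norm h0)
    have hn := norm_pos_iff.2 h0
    rw [map_smul, norm_smul, norm_inv, norm_norm, inv_mul_eq_div, div_le_div_iff₀ hm hn] at h1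
    linarith

theorem one_le_of_discInfSup {a : V₁ →L[ℝ] V₂ →L[ℝ] ℝ} {e : V₂ ≃ₗᵢ[ℝ] V₁}
    (he : ∀ v₁ v₂, a v₁ v₂ = ⟪v₁, e v₂⟫) {U : Submodule ℝ V₁} {S : Submodule ℝ V₂}
    [FiniteDimensional ℝ S] {m : ℝ} (hm : 0 < m) (hmd : 1 / m = discInfSup a U S) : 1 ≤ m := by
  have hne : {r : ℝ | ∃ v₁ ∈ U, ‖v₁‖ = 1 ∧
      r = sSup {s : ℝ | ∃ φ₂ ∈ S, ‖φ₂‖ = 1 ∧ s = a v₁ φ₂}}.Nonempty := by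
    by_contra hc
    rw [Set.not_nonempty_iff_eq_empty] at hc
    rw [discInfSup, hc, Real.sInf_empty] at hmd
    exact (one_div_pos.2 hm).ne' hmd
  obtain ⟨r, u, hu, hu1, -⟩ := hne
  have h1 := le_mul_norm_starProjection_of_discInfSup he hm hmd hu
  have h2 := Submodule.norm_starProjection_apply_le
    (S.map (e.toLinearEquiv : V₂ →ₗ[ℝ] V₁)) u
  rw [hu1] at h1 h2
  nlinarith

/-- Uniform stability of the optimality system on a pair of inf-sup stable subspaces. -/
theorem nV_le_of_bV_le {a : V₁ →L[ℝ] V₂ →L[ℝ] ℝ} {C : V₂ →L[ℝ] Q} {T : V₁ →L[ℝ] W}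
    {α m M D : ℝ} (hα : 0 < α) (hC : ‖C‖ ≤ M) (hT : ‖T‖ ≤ M) (hD : 0 ≤ D)
    {U : Submodule ℝ V₁} {S : Submodule ℝ V₂}
    (hU : ∀ v ∈ U, ∀ δ, 0 ≤ δ → (∀ φ ∈ S, a v φ ≤ δ * ‖φ‖) → ‖v‖ ≤ m * δ)
    (hS : ∀ v ∈ S, ∀ δ, 0 ≤ δ → (∀ φ ∈ U, a φ v ≤ δ * ‖φ‖) → ‖v‖ ≤ m * δ)
    {v : V₁ × V₂} (hv1 : v.1 ∈ U) (hv2 : v.2 ∈ S)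
    (hb : ∀ φ : V₁ × V₂, φ.1 ∈ U → φ.2 ∈ S → bV a C T α v φ ≤ D * (‖φ.1‖ + ‖φ.2‖)) :
    nV v ≤ (4 * m + 8 * m ^ 2 * M ^ 2 * (Real.sqrt α)⁻¹) * D := by
  set s := (Real.sqrt α)⁻¹ with hs
  have hs0 : 0 < s := by positivity
  have hM : 0 ≤ M := (norm_nonneg _).trans hC
  set N := ‖v.1‖ + ‖v.2‖ with hN
  have hN0 : 0 ≤ N := by positivity
  set t := ‖C v.2‖ + ‖T v.1‖ with ht
  have ht0 : 0 ≤ t := by positivity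
  have hdiag : s * (‖C v.2‖ ^ 2 + ‖T v.1‖ ^ 2) ≤ D * N := by
    have := hb (-v.1, v.2) (U.neg_mem hv1) hv2
    simp only [bV, aV, map_neg, inner_neg_right, neg_apply, real_inner_self_eq_norm_sq, norm_neg,
      ← hs, ← hN] at this
    linarith
  have htsq : s * t ^ 2 ≤ 2 * (D * N) := by
    nlinarith [mul_nonneg hs0.le (sq_nonneg (‖C v.2‖ - ‖T v.1‖))]
  have hst : 0 ≤ s * M * t := by positivity
  have h1 : ‖v.1‖ ≤ m * (D + s * M * t) := by
    refine hU _ hv1 _ (by positivity) fun φ hφ => ?_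
    have h := hb (0, φ) U.zero_mem hφ
    simp only [bV, aV, map_zero, zero_apply, inner_zero_right, norm_zero, ← hs] at h
    have h2 : -(s * ⟪C v.2, C φ⟫) ≤ s * (t * (M * ‖φ‖)) := by
      rw [← mul_neg]
      refine mul_le_mul_of_nonneg_left ((neg_le_abs _).trans ?_) hs0.le
      refine (abs_real_inner_le_norm _ _).trans ?_
      gcongr
      · rw [ht]; linarith [norm_nonneg (T v.1)]
      · exact C.le_of_opNorm_le hC _
    nlinarith
  have h2 : ‖v.2‖ ≤ m * (D + s * M * t) := by
    refine hS _ hv2 _ (by positivity) fun φ hφ => ?_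
    have h := hb (φ, 0) hφ S.zero_mem
    simp only [bV, aV, map_zero, inner_zero_right, norm_zero, ← hs] at h
    have h2 : s * ⟪T v.1, T φ⟫ ≤ s * (t * (M * ‖φ‖)) := by
      refine mul_le_mul_of_nonneg_left ((real_inner_le_norm _ _).trans ?_) hs0.le
      gcongr
      · rw [ht]; linarith [norm_nonneg (C v.2)]
      · exact T.le_of_opNorm_le hT _
    nlinarith
  have hBt : 2 * m * s * M * t ≤ N / 2 + 4 * m ^ 2 * s * M ^ 2 * D := by
    refine le_of_abs_le (abs_le_of_sq_le_sq ?_ (by positivity))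
    calc (2 * m * s * M * t) ^ 2 = (4 * m ^ 2 * s * M ^ 2) * (s * t ^ 2) := by ring
      _ ≤ (4 * m ^ 2 * s * M ^ 2) * (2 * (D * N)) := by gcongr
      _ ≤ _ := by nlinarith [sq_nonneg (N / 2 - 4 * m ^ 2 * s * M ^ 2 * D)]
  refine (nV_le_add v).trans ?_
  linarith

section Discretization

variable {a : V₁ →L[ℝ] V₂ →L[ℝ] ℝ} {e : V₂ ≃ₗᵢ[ℝ] V₁} {U : Submodule ℝ V₁} {S : Submodule ℝ V₂}
  {m : ℝ}

theorem eq_zero_of_forall_inner_map (he : ∀ v₁ v₂, a v₁ v₂ = ⟪v₁, e v₂⟫)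
    (hnd : ∀ v ∈ S, (∀ φ ∈ U, a φ v = 0) → v = 0) :
    ∀ s ∈ S.map (e.toLinearEquiv : V₂ →ₗ[ℝ] V₁), (∀ u ∈ U, ⟪u, s⟫ = 0) → s = 0 := by
  rintro _ ⟨v, hv, rfl⟩ h
  have hv0 : v = 0 := hnd v hv fun φ hφ => (he φ v).trans (h φ hφ)
  simp [hv0]

theorem norm_fst_le_of_discInfSup [FiniteDimensional ℝ S] (he : ∀ v₁ v₂, a v₁ v₂ = ⟪v₁, e v₂⟫)
    (hm : 0 < m) (hmd : 1 / m = discInfSup a U S) {v : V₁} (hv : v ∈ U) {δ : ℝ} (hδ : 0 ≤ δ)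
    (h : ∀ φ ∈ S, a v φ ≤ δ * ‖φ‖) : ‖v‖ ≤ m * δ := by
  refine (le_mul_norm_starProjection_of_discInfSup he hm hmd hv).trans ?_
  gcongr
  refine norm_starProjection_le _ hδ ?_
  rintro _ ⟨φ, hφ, rfl⟩
  simpa [he] using h φ hφ

theorem norm_snd_le_of_discInfSup [FiniteDimensional ℝ U] [FiniteDimensional ℝ S]
    (he : ∀ v₁ v₂, a v₁ v₂ = ⟪v₁, e v₂⟫) (hnd : ∀ v ∈ S, (∀ φ ∈ U, a φ v = 0) → v = 0)
    (hm : 0 < m) (hmd : 1 / m = discInfSup a U S) {v : V₂} (hv : v ∈ S) {δ : ℝ} (hδ : 0 ≤ δ)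
    (h : ∀ φ ∈ U, a φ v ≤ δ * ‖φ‖) : ‖v‖ ≤ m * δ := by
  have h1 := norm_le_mul_norm_starProjection_symm U (S.map (e.toLinearEquiv : V₂ →ₗ[ℝ] V₁))
    (fun u hu => le_mul_norm_starProjection_of_discInfSup he hm hmd hu)
    (eq_zero_of_forall_inner_map he hnd) (s := e v) ⟨v, hv, rfl⟩
  rw [e.norm_map] at h1
  refine h1.trans ?_
  gcongr
  refine norm_starProjection_le _ hδ fun φ hφ => ?_
  rw [real_inner_comm, ← he]
  exact h φ hφ

/-- The Ritz projection of the vectorized form `aV`, and its quasi-optimality. -/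
theorem exists_ritz_projection [FiniteDimensional ℝ U] [FiniteDimensional ℝ S]
    (he : ∀ v₁ v₂, a v₁ v₂ = ⟪v₁, e v₂⟫) (hnd : ∀ v ∈ S, (∀ φ ∈ U, a φ v = 0) → v = 0)
    (hm : 0 < m) (hmd : 1 / m = discInfSup a U S) (x : V₁ × V₂) :
    ∃ p : V₁ × V₂, p.1 ∈ U ∧ p.2 ∈ S ∧ (∀ φ ∈ S, a (x.1 - p.1) φ = 0) ∧
      (∀ φ ∈ U, a φ (x.2 - p.2) = 0) ∧ nV (x - p) ≤ m * bestErr U S x := by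
  have hm1 := one_le_of_discInfSup he hm hmd
  have hU : ∀ u ∈ U, ‖u‖ ≤ m * ‖(S.map (e.toLinearEquiv : V₂ →ₗ[ℝ] V₁)).starProjection u‖ :=
    fun u hu => le_mul_norm_starProjection_of_discInfSup he hm hmd hu
  have hS := eq_zero_of_forall_inner_map he hnd
  obtain ⟨p₁, hp₁, horth₁, hbest₁⟩ := exists_petrovGalerkin U _ hm1 hU hS x.1
  obtain ⟨_, ⟨p₂, hp₂, rfl⟩, horth₂, hbest₂⟩ := exists_petrovGalerkin
    (S.map (e.toLinearEquiv : V₂ →ₗ[ℝ] V₁)) U hm1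
    (fun s hs => norm_le_mul_norm_starProjection_symm U _ hU hS hs)
    (fun u hu h => by
      have h0 : ‖(S.map (e.toLinearEquiv : V₂ →ₗ[ℝ] V₁)).starProjection u‖ ≤ 0 :=
        norm_starProjection_le _ le_rfl fun s hs => by
          rw [real_inner_comm, h s hs, zero_mul]
      exact norm_le_zero_iff.1 ((hU u hu).trans (mul_nonpos_of_nonneg_of_nonpos hm.le h0)))
    (e x.2)
  refine ⟨(p₁, p₂), hp₁, hp₂, ?_, ?_, le_mul_bestErr hm fun v hv1 hv2 => ?_⟩
  · intro φ hφ
    rw [he]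
    exact horth₁ _ ⟨φ, hφ, rfl⟩
  · intro φ hφ
    rw [he, map_sub, real_inner_comm]
    exact horth₂ φ hφ
  · have h1 := hbest₁ v.1 hv1
    have h2 := hbest₂ (e v.2) ⟨v.2, hv2, rfl⟩
    change ‖e x.2 - e p₂‖ ≤ _ at h2
    rw [← map_sub, ← map_sub, e.norm_map, e.norm_map] at h2
    rw [nV, nV, ← Real.sqrt_sq hm.le, ← Real.sqrt_mul (sq_nonneg m)]
    refine Real.sqrt_le_sqrt ?_
    rw [mul_add, ← mul_pow, ← mul_pow]
    exact add_le_add (by gcongr; exact h1) (by gcongr; exact h2)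

/-- Aubin-Nitsche type bound for an element of `V₁` that is `a`-orthogonal to `S`. -/
theorem abs_apply_le_mul_bestErr_snd (he : ∀ v₁ v₂, a v₁ v₂ = ⟪v₁, e v₂⟫) {B : ℝ} (hB : 0 < B)
    {d : V₁} (hd : ‖d‖ ≤ B) (horth : ∀ φ ∈ S, a d φ = 0) (y : V₂) :
    |a d y| ≤ B * bestErr U S ((0, y) : V₁ × V₂) := by
  refine le_mul_bestErr hB fun v _ hv2 => ?_
  rw [← sub_zero (a d y), ← horth v.2 hv2, ← map_sub, he]
  refine (abs_real_inner_le_norm _ _).trans ?_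
  rw [e.norm_map]
  gcongr
  exact norm_snd_le_nV ((0, y) - v)

/-- Aubin-Nitsche type bound for an element of `V₂` that is `a`-orthogonal to `U`. -/
theorem abs_apply_le_mul_bestErr_fst (he : ∀ v₁ v₂, a v₁ v₂ = ⟪v₁, e v₂⟫) {B : ℝ} (hB : 0 < B)
    {d : V₂} (hd : ‖d‖ ≤ B) (horth : ∀ φ ∈ U, a φ d = 0) (y : V₁) :
    |a y d| ≤ B * bestErr U S ((y, 0) : V₁ × V₂) := by
  refine le_mul_bestErr hB fun v hv1 _ => ?_
  rw [← sub_zero (a y d), ← horth v.1 hv1, ← sub_apply, ← map_sub, he]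
  refine (abs_real_inner_le_norm _ _).trans ?_
  rw [e.norm_map, mul_comm]
  gcongr
  exact norm_fst_le_nV ((y, 0) - v)

end Discretization

/-- The supremum bounding the consistency error controls it for every discrete test function. -/
theorem consistency_le {C C' : V₂ →L[ℝ] Q} {T : V₁ →L[ℝ] W} {x₂ : V₂} {U : Submodule ℝ V₁}
    {S : Submodule ℝ V₂} {c K : ℝ} (hc : 0 ≤ c)
    (h : sSup {r : ℝ | ∃ φ : V₁ × V₂, φ.1 ∈ U ∧ φ.2 ∈ S ∧ φ ≠ 0 ∧
      r = (⟪C' x₂, C' φ.2⟫ - ⟪C x₂, C φ.2⟫) / (nV φ + c * sV C' T φ)} ≤ K)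
    {φ : V₁ × V₂} (hφ1 : φ.1 ∈ U) (hφ2 : φ.2 ∈ S) :
    ⟪C' x₂, C' φ.2⟫ - ⟪C x₂, C φ.2⟫ ≤ K * (nV φ + c * sV C' T φ) := by
  have hs : ∀ ψ : V₁ × V₂, 0 ≤ c * sV C' T ψ := fun ψ => mul_nonneg hc (Real.sqrt_nonneg _)
  rcases eq_or_ne φ 0 with rfl | h0
  · simp [nV, sV]
  rw [← div_le_iff₀ (by linarith [nV_pos h0, hs φ])]
  refine (le_csSup ⟨‖C' x₂‖ * ‖C'‖ + ‖C x₂‖ * ‖C‖, ?_⟩ ?_).trans h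
  rotate_left
  · exact ⟨φ, hφ1, hφ2, h0, rfl⟩
  rintro r ⟨ψ, -, -, hψ, rfl⟩
  rw [div_le_iff₀ (by linarith [nV_pos hψ, hs ψ])]
  have hK : 0 ≤ ‖C' x₂‖ * ‖C'‖ + ‖C x₂‖ * ‖C‖ := by positivity
  have h1 : ⟪C' x₂, C' ψ.2⟫ ≤ ‖C' x₂‖ * (‖C'‖ * ‖ψ.2‖) :=
    (real_inner_le_norm _ _).trans (by gcongr; exact C'.le_opNorm _)
  have h2 : -⟪C x₂, C ψ.2⟫ ≤ ‖C x₂‖ * (‖C‖ * ‖ψ.2‖) :=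
    (neg_le_abs _).trans ((abs_real_inner_le_norm _ _).trans (by gcongr; exact C.le_opNorm _))
  have h3 := mul_le_mul_of_nonneg_left
    ((norm_snd_le_nV ψ).trans (le_add_of_nonneg_right (hs ψ))) hK
  linarith

/-- A compactness property along sequences of positive reals tending to zero, in filter form. -/
theorem tendsto_nhdsWithin_Ioi_of_seq {Ch : ℝ → (V₂ →L[ℝ] Q)}
    (hlc : ∀ (hs : ℕ → ℝ) (d : ℕ → V₂), (∀ k, 0 < hs k) → Tendsto hs atTop (𝓝 0) →
      (∀ y : V₂, Tendsto (fun k => ⟪d k, y⟫) atTop (𝓝 0)) →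
      Tendsto (fun k => ‖Ch (hs k) (d k)‖) atTop (𝓝 0))
    {d : ℝ → V₂} (hd : ∀ y, Tendsto (fun h => ⟪d h, y⟫) (𝓝[>] 0) (𝓝 0)) :
    Tendsto (fun h => ‖Ch h (d h)‖) (𝓝[>] 0) (𝓝 0) := by
  refine tendsto_of_seq_tendsto fun u hu => ?_
  obtain ⟨N, hN⟩ := eventually_atTop.1 (hu.eventually self_mem_nhdsWithin)
  rw [← tendsto_add_atTop_iff_nat N]
  have hu' := (tendsto_add_atTop_iff_nat N).2 hu
  exact hlc (fun k => u (k + N)) (fun k => d (u (k + N))) (fun k => hN _ (Nat.le_add_left N k))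
    (hu'.mono_right nhdsWithin_le_nhds) fun y => (hd y).comp hu'

end SaddlePoint

/-- Lemma 4.4, qualitative asymptotic quasi-best approximation with
approximate control-action: if the consistency error is `o(best error)`, then
`‖x − x̃_h‖ ≤ μ_h (1 + (κ̃/√α) o(1)) inf_{v_h ∈ V_h} ‖x − v_h‖`. -/
theorem stmt12
    {V₁ V₂ Q W : Type*}
    [NormedAddCommGroup V₁] [InnerProductSpace ℝ V₁] [CompleteSpace V₁] [Nontrivial V₁]
    [NormedAddCommGroup V₂] [InnerProductSpace ℝ V₂] [CompleteSpace V₂] [Nontrivial V₂]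
    [NormedAddCommGroup Q] [InnerProductSpace ℝ Q] [CompleteSpace Q]
    [NormedAddCommGroup W] [InnerProductSpace ℝ W] [CompleteSpace W]
    (a : V₁ →L[ℝ] V₂ →L[ℝ] ℝ) (Cs : V₂ →L[ℝ] Q) (Iop : V₁ →L[ℝ] W)
    (α m_a M_I : ℝ) (hα : 0 < α)
    (hma : m_a = infSupConst a) (hma_pos : 0 < m_a)
    (hnd : ∀ v₁ : V₁, (∀ v₂ : V₂, a v₁ v₂ = 0) → v₁ = 0)
    (hadj : ∀ v₂ : V₂, ‖v₂‖ = sSup {r : ℝ | ∃ φ₁ : V₁, ‖φ₁‖ = 1 ∧ r = a φ₁ v₂})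
    (hMI : M_I = ‖Iop‖)
    -- family of discretizations and approximate control-action operators
    (Vh1 : ℝ → Submodule ℝ V₁) (Vh2 : ℝ → Submodule ℝ V₂)
    (hfd1 : ∀ h > (0 : ℝ), FiniteDimensional ℝ (Vh1 h))
    (hfd2 : ∀ h > (0 : ℝ), FiniteDimensional ℝ (Vh2 h))
    (hndh1 : ∀ h > (0 : ℝ), ∀ v₁ ∈ Vh1 h, (∀ φ₂ ∈ Vh2 h, a v₁ φ₂ = 0) → v₁ = 0)
    (hndh2 : ∀ h > (0 : ℝ), ∀ v₂ ∈ Vh2 h, (∀ φ₁ ∈ Vh1 h, a φ₁ v₂ = 0) → v₂ = 0)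
    (μ : ℝ → ℝ) (μbar : ℝ)
    (hμ_pos : ∀ h > (0 : ℝ), 0 < μ h)
    (hμ : ∀ h > (0 : ℝ), 1 / μ h = discInfSup a (Vh1 h) (Vh2 h))
    (hstab : ∀ h > (0 : ℝ), μ h ≤ μbar)
    (happrox : ∀ v : V₁ × V₂,
      Tendsto (fun h => bestErr (Vh1 h) (Vh2 h) v) (𝓝[>] (0 : ℝ)) (𝓝 0))
    (hIc : IsCompactOperator (⇑Iop))
    (Ch : ℝ → (V₂ →L[ℝ] Q))
    -- limiting compactness
    (hlc : ∀ (hs : ℕ → ℝ) (d : ℕ → V₂), (∀ k, 0 < hs k) →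
      Tendsto hs atTop (𝓝 0) →
      (∀ y : V₂, Tendsto (fun k => ⟪d k, y⟫) atTop (𝓝 0)) →
      Tendsto (fun k => ‖Ch (hs k) (d k)‖) atTop (𝓝 0))
    -- M̃ = sup_h M̃_h < ∞, L̃ = M̃/√α, κ̃
    (Mt Lt κt : ℝ)
    (hMt : Mt = sSup {r : ℝ | ∃ h > (0 : ℝ), r = max M_I ‖Ch h‖})
    (hMt_bd : ∀ h > (0 : ℝ), max M_I ‖Ch h‖ ≤ Mt)
    (hLt : Lt = Mt / Real.sqrt α)
    (hκt : κt = ((1 + 2 * Lt) / (1 + Lt)) * (1 + Mt * μbar * (1 + 2 * Mt / Real.sqrt α)))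
    -- exact and discrete solutions
    (u_d : W) (x : V₁ × V₂) (xth : ℝ → V₁ × V₂)
    (hx : ∀ φ : V₁ × V₂, bV a Cs Iop α x φ = -(Real.sqrt α)⁻¹ * ⟪u_d, Iop φ.1⟫)
    (hxth_mem : ∀ h > (0 : ℝ), (xth h).1 ∈ Vh1 h ∧ (xth h).2 ∈ Vh2 h)
    (hxth : ∀ h > (0 : ℝ), ∀ φh : V₁ × V₂, φh.1 ∈ Vh1 h → φh.2 ∈ Vh2 h →
      bV a (Ch h) Iop α (xth h) φh = -(Real.sqrt α)⁻¹ * ⟪u_d, Iop φh.1⟫)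
    -- the consistency error is dominated: `≤ ε₁(h) · best error` with `ε₁(h) → 0`
    (ε₁ : ℝ → ℝ) (hε₁_nonneg : ∀ h, 0 ≤ ε₁ h)
    (hε₁_to0 : Tendsto ε₁ (𝓝[>] (0 : ℝ)) (𝓝 0))
    (hcons : ∀ h > (0 : ℝ),
      sSup {r : ℝ | ∃ φh : V₁ × V₂, φh.1 ∈ Vh1 h ∧ φh.2 ∈ Vh2 h ∧ φh ≠ 0 ∧
        r = (⟪Ch h x.2, Ch h φh.2⟫ - ⟪Cs x.2, Cs φh.2⟫) /
          (nV φh + (max M_I ‖Ch h‖ / Real.sqrt α) * sV (Ch h) Iop φh)} ≤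
      ε₁ h * bestErr (Vh1 h) (Vh2 h) x) :
    ∃ ε : ℝ → ℝ, (∀ h, 0 ≤ ε h) ∧ Tendsto ε (𝓝[>] (0 : ℝ)) (𝓝 0) ∧
      ∀ h > (0 : ℝ), nV (x - xth h) ≤
        μ h * (1 + (κt / Real.sqrt α) * ε h) * bestErr (Vh1 h) (Vh2 h) x := by
  obtain ⟨e, he⟩ := exists_linearIsometryEquiv_of_adjoint_norm a hnd hadj
  have hm1 : ∀ h > (0 : ℝ), 1 ≤ μ h := fun h hh => by
    have := hfd2 h hh
    exact one_le_of_discInfSup he (hμ_pos h hh) (hμ h hh)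
  have hritz : ∀ h : ℝ, ∃ p : V₁ × V₂, 0 < h → p.1 ∈ Vh1 h ∧ p.2 ∈ Vh2 h ∧
      (∀ φ ∈ Vh2 h, a (x.1 - p.1) φ = 0) ∧ (∀ φ ∈ Vh1 h, a φ (x.2 - p.2) = 0) ∧
      nV (x - p) ≤ μ h * bestErr (Vh1 h) (Vh2 h) x := fun h => by
    by_cases hh : 0 < h
    · have := hfd1 h hh
      have := hfd2 h hh
      obtain ⟨p, hp⟩ := exists_ritz_projection he (hndh2 h hh) (hμ_pos h hh) (hμ h hh) x
      exact ⟨p, fun _ => hp⟩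
    · exact ⟨0, fun hh' => absurd hh' hh⟩
  choose p hp using hritz
  have hμbar : 1 ≤ μbar := (hm1 1 one_pos).trans (hstab 1 one_pos)
  have hμbar0 : 0 < μbar := by linarith
  set E : ℝ → ℝ := fun h => bestErr (Vh1 h) (Vh2 h) x
  have hE0 : ∀ h, 0 ≤ E h := fun h => bestErr_nonneg _ _ _
  set d : ℝ → V₁ × V₂ := fun h => (E h)⁻¹ • (x - p h) with hd
  have hdE : ∀ h > (0 : ℝ), x - p h = E h • d h := fun h hh => by
    rcases eq_or_ne (E h) 0 with h0 | h0
    · have h1 : nV (x - p h) ≤ 0 := by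
        simpa [show bestErr (Vh1 h) (Vh2 h) x = 0 from h0] using (hp h hh).2.2.2.2
      rw [h0, zero_smul]
      by_contra hne
      exact (nV_pos hne).not_ge h1
    · rw [hd, smul_inv_smul₀ h0]
  have hdB : ∀ h > (0 : ℝ), (E h)⁻¹ * nV (x - p h) ≤ μbar := fun h hh => by
    rcases (hE0 h).eq_or_lt with h0 | h0
    · simpa [← h0] using hμbar0.le
    · rw [inv_mul_le_iff₀ h0, mul_comm]
      exact (hp h hh).2.2.2.2.trans (mul_le_mul_of_nonneg_right (hstab h hh) (hE0 h))
  have hd1 : ∀ h > (0 : ℝ), ‖(d h).1‖ ≤ μbar := fun h hh => by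
    refine le_trans ?_ (hdB h hh)
    rw [hd, Prod.smul_fst, norm_smul, Real.norm_of_nonneg (inv_nonneg.2 (hE0 h))]
    exact mul_le_mul_of_nonneg_left (norm_fst_le_nV (x - p h)) (inv_nonneg.2 (hE0 h))
  have hd2 : ∀ h > (0 : ℝ), ‖(d h).2‖ ≤ μbar := fun h hh => by
    refine le_trans ?_ (hdB h hh)
    rw [hd, Prod.smul_snd, norm_smul, Real.norm_of_nonneg (inv_nonneg.2 (hE0 h))]
    exact mul_le_mul_of_nonneg_left (norm_snd_le_nV (x - p h)) (inv_nonneg.2 (hE0 h))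
  have hpos : ∀ᶠ h in 𝓝[>] (0 : ℝ), 0 < h := self_mem_nhdsWithin
  have hweak1 : ∀ y, Tendsto (fun h => ⟪(d h).1, y⟫) (𝓝[>] 0) (𝓝 0) := fun y => by
    have hlim := (happrox (0, e.symm y)).const_mul μbar
    rw [mul_zero] at hlim
    refine squeeze_zero_norm' (hpos.mono fun h hh => ?_) hlim
    have h1 := abs_apply_le_mul_bestErr_snd (U := Vh1 h) (S := Vh2 h) he hμbar0 (hd1 h hh)
      (fun φ hφ => by simp [hd, -map_sub, (hp h hh).2.2.1 φ hφ]) (e.symm y)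
    rwa [he, e.apply_symm_apply] at h1
  have hweak2 : ∀ y, Tendsto (fun h => ⟪(d h).2, y⟫) (𝓝[>] 0) (𝓝 0) := fun y => by
    have hlim := (happrox (e y, 0)).const_mul μbar
    rw [mul_zero] at hlim
    refine squeeze_zero_norm' (hpos.mono fun h hh => ?_) hlim
    have h1 := abs_apply_le_mul_bestErr_fst (U := Vh1 h) (S := Vh2 h) he hμbar0 (hd2 h hh)
      (fun φ hφ => by simp [hd, -map_sub, (hp h hh).2.2.2.1 φ hφ]) (e y)
    rwa [he, e.inner_map_map, real_inner_comm] at h1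
  have hlimC := tendsto_nhdsWithin_Ioi_of_seq hlc hweak2
  have hlimI : Tendsto (fun h => ‖Iop (d h).1‖) (𝓝[>] 0) (𝓝 0) := by
    simpa using (hIc.tendsto_zero_of_weakly (hpos.mono hd1) hweak1).norm
  have hI : ∀ h > (0 : ℝ), ‖Iop‖ ≤ Mt := fun h hh =>
    hMI ▸ (le_max_left _ _).trans (hMt_bd h hh)
  have hC : ∀ h > (0 : ℝ), ‖Ch h‖ ≤ Mt := fun h hh => (le_max_right _ _).trans (hMt_bd h hh)
  have hMt0 : 0 ≤ Mt := (norm_nonneg _).trans (hI 1 one_pos)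
  set s := (Real.sqrt α)⁻¹ with hs
  have hs0 : 0 < s := by positivity
  set G : ℝ := 4 * μbar + 8 * μbar ^ 2 * Mt ^ 2 * s
  have hG0 : 0 ≤ G := by positivity
  set δ : ℝ → ℝ := fun h =>
    s * (1 + Mt * s * Mt) * ε₁ h + s * Mt * (‖Ch h (d h).2‖ + ‖Iop (d h).1‖) with hδ
  have hδ0 : ∀ h, 0 ≤ δ h := fun h => by
    have := hε₁_nonneg h
    positivity
  have hδlim : Tendsto δ (𝓝[>] 0) (𝓝 0) := by
    simpa using (hε₁_to0.const_mul (s * (1 + Mt * s * Mt))).add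
      ((hlimC.add hlimI).const_mul (s * Mt))
  have hstable : ∀ h > (0 : ℝ), nV (p h - xth h) ≤ G * (δ h * E h) := fun h hh => by
    have := hfd1 h hh
    have := hfd2 h hh
    obtain ⟨hp1, hp2, horth1, horth2, -⟩ := hp h hh
    have hx1 : x.1 - (p h).1 = E h • (d h).1 := congrArg Prod.fst (hdE h hh)
    have hx2 : x.2 - (p h).2 = E h • (d h).2 := congrArg Prod.snd (hdE h hh)
    refine nV_le_of_bV_le hα (hC h hh) (hI h hh) (mul_nonneg (hδ0 h) (hE0 h))
      (a := a) (U := Vh1 h) (S := Vh2 h) (fun v hv η hη hb => ?_) (fun v hv η hη hb => ?_)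
      ((Vh1 h).sub_mem hp1 (hxth_mem h hh).1) ((Vh2 h).sub_mem hp2 (hxth_mem h hh).2)
      fun φ hφ1 hφ2 => ?_
    · exact (norm_fst_le_of_discInfSup he (hμ_pos h hh) (hμ h hh) hv hη hb).trans
        (mul_le_mul_of_nonneg_right (hstab h hh) hη)
    · exact (norm_snd_le_of_discInfSup he (hndh2 h hh) (hμ_pos h hh) (hμ h hh) hv hη hb).trans
        (mul_le_mul_of_nonneg_right (hstab h hh) hη)
    · set N := ‖φ.1‖ + ‖φ.2‖ with hN
      have hN0 : 0 ≤ N := by positivity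
      have hcons' : ⟪Ch h x.2, Ch h φ.2⟫ - ⟪Cs x.2, Cs φ.2⟫ ≤
          ε₁ h * E h * ((1 + Mt * s * Mt) * N) := by
        refine (consistency_le (div_nonneg ((norm_nonneg _).trans (le_max_right _ _))
          (Real.sqrt_nonneg _)) (hcons h hh) hφ1 hφ2).trans ?_
        refine mul_le_mul_of_nonneg_left ?_ (mul_nonneg (hε₁_nonneg h) (hE0 h))
        rw [add_mul, one_mul, mul_assoc (Mt * s), div_eq_mul_inv]
        refine add_le_add (nV_le_add φ) ?_
        gcongr
        · exact Real.sqrt_nonneg _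
        · exact hMt_bd h hh
        · exact sV_le (hC h hh) (hI h hh) φ
      have hCd : -⟪Ch h (x.2 - (p h).2), Ch h φ.2⟫ ≤ E h * ‖Ch h (d h).2‖ * (Mt * N) := by
        refine (neg_le_abs _).trans ((abs_real_inner_le_norm _ _).trans ?_)
        rw [hx2, map_smul, norm_smul, Real.norm_of_nonneg (hE0 h)]
        have := hE0 h
        gcongr
        exact ((Ch h).le_of_opNorm_le (hC h hh) _).trans
          (mul_le_mul_of_nonneg_left (by linarith [norm_nonneg φ.1]) hMt0)
      have hId : ⟪Iop (x.1 - (p h).1), Iop φ.1⟫ ≤ E h * ‖Iop (d h).1‖ * (Mt * N) := by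
        refine (real_inner_le_norm _ _).trans ?_
        rw [hx1, map_smul, norm_smul, Real.norm_of_nonneg (hE0 h)]
        have := hE0 h
        gcongr
        exact (Iop.le_of_opNorm_le (hI h hh) _).trans
          (mul_le_mul_of_nonneg_left (by linarith [norm_nonneg φ.2]) hMt0)
      have hxφ := (hx φ).trans (hxth h hh φ hφ1 hφ2).symm
      have ho1 := horth1 φ.2 hφ2
      have ho2 := horth2 φ.1 hφ1
      have hexp : bV a (Ch h) Iop α (p h - xth h) φ =
          s * ((⟪Ch h x.2, Ch h φ.2⟫ - ⟪Cs x.2, Cs φ.2⟫) +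
            -⟪Ch h (x.2 - (p h).2), Ch h φ.2⟫ + ⟪Iop (x.1 - (p h).1), Iop φ.1⟫) := by
        simp only [bV, aV, Prod.fst_sub, Prod.snd_sub, map_sub, sub_apply, inner_sub_left,
          ← hs] at hxφ ho1 ho2 ⊢
        linarith
      rw [hexp]
      refine (mul_le_mul_of_nonneg_left (add_le_add (add_le_add hcons' hCd) hId) hs0.le).trans
        (le_of_eq ?_)
      simp only [hδ]
      ring
  have hκ : 0 < κt := by
    have hLt0 : 0 ≤ Lt := by rw [hLt]; positivity
    rw [hκt]
    positivity
  have hc : 0 < κt / Real.sqrt α := by positivity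
  refine ⟨fun h => (κt / Real.sqrt α)⁻¹ * G * δ h, fun h => ?_, ?_, fun h hh => ?_⟩
  · have := hδ0 h
    positivity
  · simpa using hδlim.const_mul ((κt / Real.sqrt α)⁻¹ * G)
  · have hsplit : x - xth h = (x - p h) + (p h - xth h) := by abel
    have h1 := (hp h hh).2.2.2.2
    have h2 : G * (δ h * E h) ≤ μ h * (G * δ h) * E h := by
      have h3 : 0 ≤ G * δ h * E h := mul_nonneg (mul_nonneg hG0 (hδ0 h)) (hE0 h)
      nlinarith [hm1 h hh]
    have h4 : κt / Real.sqrt α * ((κt / Real.sqrt α)⁻¹ * G * δ h) = G * δ h := by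
      rw [← mul_assoc, mul_inv_cancel_left₀ hc.ne']
    rw [hsplit, h4, mul_add, mul_one, add_mul]
    exact (nV_add_le _ _).trans (add_le_add h1 ((hstable h hh).trans h2))
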